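/- arXiv:1505.01696 — 3 statements merged into one kernel-verified Lean document; each statement's English description precedes it below -/
import Mathlib

section
/- Let {U_i}_{i=0}^d and {U′_i}_{i=0}^d be flags on V. Then {U_i} and {U′_i} are opposite if and only if there exists A ∈ End(V) that lowers {U_i} and raises {U′_i}. Moreover, if these equivalent conditions hold and V_i := U_i ∩ U′_{d−i} for 0 ≤ i ≤ d, then {V_i}_{i=0}^d is a decomposition of V that is lowered by A. -/
variable (F : Type*) [Field F] {V : Type*} [AddCommGroup V] [Module F V]

/-- A flag on `V` (of diameter `d`): a nested sequence of subspaces `U 0 ⊆ ⋯ ⊆ U d`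
with `dim (U i) = i + 1`. -/
def IsFlag (d : ℕ) (U : ℕ → Submodule F V) : Prop :=
  (∀ i ≤ d, Module.finrank F (U i) = i + 1) ∧
  ∀ i : ℕ, i + 1 ≤ d → U i ≤ U (i + 1)

/-- `A` lowers the flag `U`. -/
def LowersFlag (d : ℕ) (A : Module.End F V) (U : ℕ → Submodule F V) : Prop :=
  Submodule.map A (U 0) = ⊥ ∧
  ∀ i : ℕ, 1 ≤ i → i ≤ d → Submodule.map A (U i) = U (i - 1)

/-- `A` raises the flag `U`. -/
def RaisesFlag (d : ℕ) (A : Module.End F V) (U : ℕ → Submodule F V) : Prop :=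
  ∀ i : ℕ, i + 1 ≤ d → U i ⊔ Submodule.map A (U i) = U (i + 1)

/-- `W 0, …, W d` is a decomposition of `V`: one-dimensional subspaces whose
direct sum is `V`. -/
def IsDecomposition (d : ℕ) (W : ℕ → Submodule F V) : Prop :=
  (∀ i ≤ d, Module.finrank F (W i) = 1) ∧
  DirectSum.IsInternal (fun i : Fin (d + 1) => W (i : ℕ))

/-- `A` lowers the decomposition `W`. -/
def LowersDecomposition (d : ℕ) (A : Module.End F V) (W : ℕ → Submodule F V) : Prop :=
  Submodule.map A (W 0) = ⊥ ∧
  ∀ i : ℕ, 1 ≤ i → i ≤ d → Submodule.map A (W i) = W (i - 1)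

variable {F}

theorem IsFlag.eq_top [FiniteDimensional F V] {d : ℕ} (hdim : Module.finrank F V = d + 1)
    {U : ℕ → Submodule F V} (hU : IsFlag F d U) : U d = ⊤ :=
  Submodule.eq_top_of_finrank_eq ((hU.1 d le_rfl).trans hdim.symm)

variable (F) in
/-- Two sequences of subspaces are opposite when `U i` and `U' j` meet trivially for
`i + j < d`. -/
def OppositeFlags (d : ℕ) (U U' : ℕ → Submodule F V) : Prop :=
  ∀ i j : ℕ, i ≤ d → j ≤ d → i + j < d → U i ⊓ U' j = ⊥

theorem OppositeFlags.symm {d : ℕ} {U U' : ℕ → Submodule F V} (h : OppositeFlags F d U U') :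
    OppositeFlags F d U' U := fun i j hi hj hij => by
  rw [inf_comm]
  exact h j i hj hi (by omega)

/-- A raising map moves a vector lying in `U j` but in no earlier member outside of `U j`. -/
theorem RaisesFlag.apply_notMem [FiniteDimensional F V] {d : ℕ} {A : Module.End F V}
    {U : ℕ → Submodule F V} (hU : IsFlag F d U) (hA : RaisesFlag F d A U) {j : ℕ} (hj : j < d)
    {x : V} (hx0 : x ≠ 0) (hx : x ∈ U j) (hlt : ∀ k < j, x ∉ U k) : A x ∉ U j := by
  intro hAx
  have hmap : Submodule.map A (U j) ≤ U j := by
    rcases j with _ | k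
    · have h1 := hU.1 0 (by omega)
      have hspan : Submodule.span F {x} = U 0 := by
        apply Submodule.eq_of_le_of_finrank_eq
        · simpa using hx
        · rw [finrank_span_singleton hx0, h1]
      rw [Submodule.map_le_iff_le_comap]
      conv_lhs => rw [← hspan]
      simpa using hAx
    · have hsup : U k ⊔ Submodule.span F {x} = U (k + 1) := by
        have hle : U k ⊔ Submodule.span F {x} ≤ U (k + 1) :=
          sup_le (hU.2 k (by omega)) (by simpa using hx)
        have hlt' : U k < U k ⊔ Submodule.span F {x} := by
          refine lt_of_le_of_ne le_sup_left fun h => hlt k (by omega) ?_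
          rw [h]
          exact Submodule.mem_sup_right (Submodule.mem_span_singleton_self x)
        have h1 := Submodule.finrank_lt_finrank_of_lt hlt'
        apply Submodule.eq_of_le_of_finrank_le hle
        rw [hU.1 _ (by omega)] at h1 ⊢
        omega
      rw [Submodule.map_le_iff_le_comap]
      conv_lhs => rw [← hsup]
      refine sup_le ?_ (by simpa using hAx)
      rw [← Submodule.map_le_iff_le_comap, ← hA k (by omega)]
      exact le_sup_right
  have h := hA j hj
  rw [sup_eq_left.mpr hmap] at h
  have h1 := hU.1 j (by omega)
  have h2 := hU.1 (j + 1) (by omega)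
  rw [h] at h1
  omega

theorem oppositeFlags_of_lowers_of_raises [FiniteDimensional F V] {d : ℕ} {A : Module.End F V}
    {U U' : ℕ → Submodule F V} (hU' : IsFlag F d U') (hA : LowersFlag F d A U)
    (hA' : RaisesFlag F d A U') : OppositeFlags F d U U' := by
  classical
  intro i
  induction i with
  | zero =>
    intro j _ _ hij
    rw [Submodule.eq_bot_iff]
    rintro x ⟨hx, hx'⟩
    by_contra hx0
    have hex : ∃ k, x ∈ U' k := ⟨j, hx'⟩
    have hk : Nat.find hex ≤ j := Nat.find_le hx'
    refine hA'.apply_notMem hU' (by omega) hx0 (Nat.find_spec hex)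
      (fun k hk => Nat.find_min hex hk) ?_
    have h0 : A x ∈ Submodule.map A (U 0) := Submodule.mem_map_of_mem hx
    rw [hA.1, Submodule.mem_bot] at h0
    rw [h0]
    exact zero_mem _
  | succ i ih =>
    intro j _ _ hij
    rw [Submodule.eq_bot_iff]
    rintro x ⟨hx, hx'⟩
    by_contra hx0
    have hex : ∃ k, x ∈ U' k := ⟨j, hx'⟩
    have hk : Nat.find hex ≤ j := Nat.find_le hx'
    refine hA'.apply_notMem hU' (by omega) hx0 (Nat.find_spec hex)
      (fun k hk => Nat.find_min hex hk) ?_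
    have h0 : A x ∈ Submodule.map A (U (i + 1)) := Submodule.mem_map_of_mem hx
    rw [hA.2 (i + 1) (by omega) (by omega)] at h0
    have h1 : A x ∈ U' (Nat.find hex + 1) := by
      rw [← hA' _ (by omega)]
      exact Submodule.mem_sup_right (Submodule.mem_map_of_mem (Nat.find_spec hex))
    have h2 : A x ∈ U i ⊓ U' (Nat.find hex + 1) := ⟨h0, h1⟩
    rw [ih _ (by omega) (by omega) (by omega), Submodule.mem_bot] at h2
    rw [h2]
    exact zero_mem _

namespace OppositeFlags

variable [FiniteDimensional F V] {d : ℕ} {U U' : ℕ → Submodule F V}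

theorem finrank_inf (hdim : Module.finrank F V = d + 1) (hU : IsFlag F d U)
    (hU' : IsFlag F d U') (h : OppositeFlags F d U U') {i : ℕ} (hi : i ≤ d) :
    Module.finrank F ↥(U i ⊓ U' (d - i)) = 1 := by
  have h1 := Submodule.finrank_sup_add_finrank_inf_eq (U i) (U' (d - i))
  have h2 := Submodule.finrank_le (U i ⊔ U' (d - i))
  rw [hU.1 i hi, hU'.1 (d - i) (by omega)] at h1
  rcases i with _ | i
  · have h3 := Submodule.finrank_mono (inf_le_left : U 0 ⊓ U' (d - 0) ≤ U 0)
    rw [hU.1 0 hi] at h3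
    omega
  · have h3 := Submodule.finrank_sup_add_finrank_inf_eq (U i) (U (i + 1) ⊓ U' (d - (i + 1)))
    have h4 : U i ⊓ (U (i + 1) ⊓ U' (d - (i + 1))) = ⊥ := by
      rw [← inf_assoc, inf_eq_left.mpr (hU.2 i hi)]
      exact h i _ (by omega) (by omega) (by omega)
    have h5 := Submodule.finrank_mono (sup_le (hU.2 i hi) inf_le_left :
      U i ⊔ U (i + 1) ⊓ U' (d - (i + 1)) ≤ U (i + 1))
    rw [h4, finrank_bot, hU.1 i (by omega)] at h3
    rw [hU.1 (i + 1) hi] at h5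
    omega

theorem sup_inf_eq (hdim : Module.finrank F V = d + 1) (hU : IsFlag F d U)
    (hU' : IsFlag F d U') (h : OppositeFlags F d U U') {i : ℕ} (hi : i + 1 ≤ d) :
    U i ⊔ U (i + 1) ⊓ U' (d - (i + 1)) = U (i + 1) := by
  apply Submodule.eq_of_le_of_finrank_eq (sup_le (hU.2 i hi) inf_le_left)
  have h3 := Submodule.finrank_sup_add_finrank_inf_eq (U i) (U (i + 1) ⊓ U' (d - (i + 1)))
  have h4 : U i ⊓ (U (i + 1) ⊓ U' (d - (i + 1))) = ⊥ := by
    rw [← inf_assoc, inf_eq_left.mpr (hU.2 i hi)]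
    exact h i _ (by omega) (by omega) (by omega)
  rw [h4, finrank_bot, hU.1 i (by omega), finrank_inf hdim hU hU' h hi] at h3
  rw [hU.1 _ hi]
  omega

/-- Opposite flags admit an adapted basis. -/
theorem exists_basis (hdim : Module.finrank F V = d + 1) (hU : IsFlag F d U)
    (hU' : IsFlag F d U') (h : OppositeFlags F d U U') :
    ∃ b : Module.Basis (Fin (d + 1)) F V,
      ∀ i : Fin (d + 1), U i ⊓ U' (d - i) = Submodule.span F {b i} := by
  have hex : ∀ i : Fin (d + 1), ∃ v : V, U i ⊓ U' (d - i) = Submodule.span F {v} := by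
    intro i
    have hone := finrank_inf hdim hU hU' h (Nat.lt_succ_iff.mp i.2)
    obtain ⟨v, hv, hv0⟩ := Submodule.exists_mem_ne_zero_of_ne_bot
      (Submodule.one_le_finrank_iff.mp hone.ge)
    refine ⟨v, (Submodule.eq_of_le_of_finrank_eq ?_ ?_).symm⟩
    · simpa using hv
    · rw [finrank_span_singleton hv0, hone]
  choose v hv using hex
  have hmem : ∀ i : Fin (d + 1), U i ⊓ U' (d - i) ≤ Submodule.span F (Set.range v) := by
    intro i
    rw [hv i]
    exact Submodule.span_mono (by simp)
  have hle : ∀ i ≤ d, U i ≤ Submodule.span F (Set.range v) := by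
    intro i
    induction i with
    | zero =>
      intro _
      have h0 := hmem 0
      simpa [hU'.eq_top hdim] using h0
    | succ i ih =>
      intro hi
      rw [← sup_inf_eq hdim hU hU' h hi]
      exact sup_le (ih (by omega)) (hmem ⟨i + 1, by omega⟩)
  have htop : ⊤ ≤ Submodule.span F (Set.range v) := by
    rw [← hU.eq_top hdim]
    exact hle d le_rfl
  refine ⟨basisOfTopLeSpanOfCardEqFinrank v htop (by rw [Fintype.card_fin, hdim]), fun i => ?_⟩
  rw [coe_basisOfTopLeSpanOfCardEqFinrank]
  exact hv i

theorem isDecomposition (hdim : Module.finrank F V = d + 1) (hU : IsFlag F d U)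
    (hU' : IsFlag F d U') (h : OppositeFlags F d U U') :
    IsDecomposition F d (fun i => U i ⊓ U' (d - i)) := by
  refine ⟨fun i hi => finrank_inf hdim hU hU' h hi, ?_⟩
  obtain ⟨b, hb⟩ := exists_basis hdim hU hU' h
  have hfun : (fun i : Fin (d + 1) => U i ⊓ U' (d - i)) = fun i => Submodule.span F {b i} :=
    funext hb
  change DirectSum.IsInternal (fun i : Fin (d + 1) => U i ⊓ U' (d - i))
  rw [hfun]
  apply DirectSum.isInternal_submodule_of_iSupIndep_of_iSup_eq_top
  · exact b.linearIndependent.iSupIndep_span_singleton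
  · rw [← Submodule.span_range_eq_iSup, b.span_eq]

theorem exists_lowersDecomposition (hdim : Module.finrank F V = d + 1) (hU : IsFlag F d U)
    (hU' : IsFlag F d U') (h : OppositeFlags F d U U') :
    ∃ A : Module.End F V, LowersDecomposition F d A (fun i => U i ⊓ U' (d - i)) := by
  obtain ⟨b, hb⟩ := exists_basis hdim hU hU' h
  refine ⟨b.constr F (Fin.cases 0 fun k : Fin d => b k.castSucc), ?_, ?_⟩
  · have h0 := hb 0
    simp only [Fin.val_zero] at h0
    change Submodule.map _ (U 0 ⊓ U' (d - 0)) = ⊥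
    rw [h0, Submodule.map_span, Set.image_singleton, Module.Basis.constr_basis]
    simp
  · intro i hi1 hi
    obtain ⟨k, rfl⟩ : ∃ k, i = k + 1 := ⟨i - 1, by omega⟩
    have h1 := hb (Fin.succ ⟨k, by omega⟩)
    have h2 := hb (Fin.castSucc ⟨k, by omega⟩)
    simp only [Fin.val_succ] at h1
    simp only [Fin.val_castSucc] at h2
    change Submodule.map _ (U (k + 1) ⊓ U' (d - (k + 1))) = U k ⊓ U' (d - k)
    rw [h1, h2, Submodule.map_span, Set.image_singleton, Module.Basis.constr_basis]
    simp

theorem lowersFlag (hdim : Module.finrank F V = d + 1) (hU : IsFlag F d U)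
    (hU' : IsFlag F d U') (h : OppositeFlags F d U U') {A : Module.End F V}
    (hA : LowersDecomposition F d A (fun i => U i ⊓ U' (d - i))) : LowersFlag F d A U := by
  have h0 : Submodule.map A (U 0) = ⊥ := by simpa [hU'.eq_top hdim] using hA.1
  have hstep : ∀ i, i + 1 ≤ d → Submodule.map A (U (i + 1)) = U i := by
    intro i
    induction i with
    | zero =>
      intro hi
      rw [← sup_inf_eq hdim hU hU' h hi, Submodule.map_sup, h0, bot_sup_eq]
      simpa [hU'.eq_top hdim] using hA.2 1 le_rfl hi
    | succ i ih =>
      intro hi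
      rw [← sup_inf_eq hdim hU hU' h hi, Submodule.map_sup, ih (by omega)]
      have h1 := hA.2 (i + 1 + 1) (by omega) hi
      simp only [Nat.add_sub_cancel] at h1
      rw [h1]
      exact sup_inf_eq hdim hU hU' h (by omega)
  refine ⟨h0, fun i hi1 hi => ?_⟩
  obtain ⟨k, rfl⟩ : ∃ k, i = k + 1 := ⟨i - 1, by omega⟩
  exact hstep k hi

theorem raisesFlag (hdim : Module.finrank F V = d + 1) (hU : IsFlag F d U)
    (hU' : IsFlag F d U') (h : OppositeFlags F d U U') {A : Module.End F V}
    (hA : LowersDecomposition F d A (fun i => U i ⊓ U' (d - i))) : RaisesFlag F d A U' := by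
  have hmap : ∀ k, k + 1 ≤ d →
      Submodule.map A (U' k ⊓ U (d - k)) = U' (k + 1) ⊓ U (d - (k + 1)) := by
    intro k hk
    have h1 := hA.2 (d - k) (by omega) (by omega)
    simp only [show d - (d - k) = k by omega, show d - k - 1 = d - (k + 1) by omega,
      show d - (d - (k + 1)) = k + 1 by omega] at h1
    rw [inf_comm, h1, inf_comm]
  intro i
  induction i with
  | zero =>
    intro hi
    have h1 := hmap 0 hi
    simp only [Nat.sub_zero, hU.eq_top hdim, inf_top_eq] at h1
    rw [h1]
    exact sup_inf_eq hdim hU' hU h.symm hi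
  | succ i ih =>
    intro hi
    have hle : Submodule.map A (U' i) ≤ U' (i + 1) := by
      rw [← ih (by omega)]
      exact le_sup_right
    have h1 : Submodule.map A (U' (i + 1)) =
        Submodule.map A (U' i) ⊔ U' (i + 1 + 1) ⊓ U (d - (i + 1 + 1)) := by
      rw [← hmap (i + 1) hi, ← Submodule.map_sup, sup_inf_eq hdim hU' hU h.symm (by omega)]
    rw [h1, ← sup_assoc, sup_eq_left.mpr hle]
    exact sup_inf_eq hdim hU' hU h.symm hi

theorem lowersDecomposition (hdim : Module.finrank F V = d + 1) (hU : IsFlag F d U)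
    (hU' : IsFlag F d U') (h : OppositeFlags F d U U') {A : Module.End F V}
    (hA : LowersFlag F d A U) (hA' : RaisesFlag F d A U') :
    LowersDecomposition F d A (fun i => U i ⊓ U' (d - i)) := by
  refine ⟨?_, fun i hi1 hi => ?_⟩
  · rw [eq_bot_iff, ← hA.1]
    exact Submodule.map_mono inf_le_left
  obtain ⟨k, rfl⟩ : ∃ k, i = k + 1 := ⟨i - 1, by omega⟩
  change Submodule.map A (U (k + 1) ⊓ U' (d - (k + 1))) = U k ⊓ U' (d - k)
  have hlow : Submodule.map A (U (k + 1)) = U k := hA.2 (k + 1) hi1 hi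
  have hle : Submodule.map A (U (k + 1) ⊓ U' (d - (k + 1))) ≤ U k ⊓ U' (d - k) := by
    refine le_inf ((Submodule.map_mono inf_le_left).trans hlow.le) ?_
    rw [show d - k = d - (k + 1) + 1 by omega, ← hA' (d - (k + 1)) (by omega)]
    exact (Submodule.map_mono inf_le_right).trans le_sup_right
  apply Submodule.eq_of_le_of_finrank_le hle
  rw [finrank_inf hdim hU hU' h (by omega), Submodule.one_le_finrank_iff]
  intro hbot
  have heq : Submodule.map A (U k) = U k := by
    rw [← sup_inf_eq hdim hU hU' h hi, Submodule.map_sup, hbot, sup_bot_eq] at hlow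
    exact hlow
  have hk := hU.1 k (by omega)
  rcases k with _ | k
  · rw [← heq, hA.1, finrank_bot] at hk
    omega
  · have h1 := hA.2 (k + 1) (by omega) (by omega)
    rw [heq, Nat.add_sub_cancel] at h1
    rw [h1, hU.1 k (by omega)] at hk
    omega

end OppositeFlags

variable (F)

theorem stmt2 [FiniteDimensional F V] (d : ℕ) (hdim : Module.finrank F V = d + 1)
    (U U' : ℕ → Submodule F V) (hU : IsFlag F d U) (hU' : IsFlag F d U') :
    ((∀ i j : ℕ, i ≤ d → j ≤ d → i + j < d → U i ⊓ U' j = ⊥) ↔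
      ∃ A : Module.End F V, LowersFlag F d A U ∧ RaisesFlag F d A U') ∧
    (∀ A : Module.End F V, LowersFlag F d A U → RaisesFlag F d A U' →
      IsDecomposition F d (fun i => U i ⊓ U' (d - i)) ∧
      LowersDecomposition F d A (fun i => U i ⊓ U' (d - i))) := by
  refine ⟨⟨fun h => ?_, fun ⟨A, hA, hA'⟩ => oppositeFlags_of_lowers_of_raises hU' hA hA'⟩,
    fun A hA hA' => ?_⟩
  · have hopp : OppositeFlags F d U U' := h
    obtain ⟨A, hA⟩ := hopp.exists_lowersDecomposition hdim hU hU'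
    exact ⟨A, hopp.lowersFlag hdim hU hU' hA, hopp.raisesFlag hdim hU hU' hA⟩
  · have hopp := oppositeFlags_of_lowers_of_raises hU' hA hA'
    exact ⟨hopp.isDecomposition hdim hU hU', hopp.lowersDecomposition hdim hU hU' hA hA'⟩
end

section
/- Let F be a field, let n ≥ 0 be an even integer, and let ρ_0,…,ρ_n be a sequence in F. The following are equivalent: (i) the sequence (ρ_i) is constrained; (ii) the sequence (ρ_i) is geometric and ρ_{n/2} ∈ {1,−1}; (iii) there exist a nonzero r ∈ F and ε ∈ {1,−1} such that ρ_i r^{n/2} = ε r^i for 0 ≤ i ≤ n. Moreover, if (i)–(iii) hold, then ε = ρ_{n/2} and r = ρ_i/ρ_{i−1} for 1 ≤ i ≤ n. -/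
/-- The sequence `ρ 0, …, ρ n` is constrained. -/
def Constrained (F : Type*) [Field F] (n : ℕ) (ρ : ℕ → F) : Prop :=
  (∀ i ≤ n, ρ i * ρ (n - i) = 1) ∧
  ∃ a b c : F, ¬(a = 0 ∧ b = 0 ∧ c = 0) ∧
    ∀ i : ℕ, 1 ≤ i → i + 1 ≤ n → a * ρ (i - 1) + b * ρ i + c * ρ (i + 1) = 0

/-- The sequence `ρ 0, …, ρ n` is geometric. -/
def GeometricSeq (F : Type*) [Field F] (n : ℕ) (ρ : ℕ → F) : Prop :=
  (∀ i ≤ n, ρ i ≠ 0) ∧ ∃ r : F, ∀ i : ℕ, 1 ≤ i → i ≤ n → ρ i = r * ρ (i - 1)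

/-- A constrained sequence of odd length `2 m + 1` is geometric to the right of its midpoint. -/
theorem Constrained.apply_add_eq {F : Type*} [Field F] {m : ℕ} {ρ : ℕ → F}
    (h : Constrained F (m + m) ρ) (k : ℕ) (hk : k ≤ m) :
    ρ (m + k) = ρ m * (ρ m * ρ (m + 1)) ^ k := by
  obtain ⟨hinv, a, b, c, habc, hrec⟩ := h
  have hmid : ρ m * ρ m = 1 := by simpa using hinv m (by omega)
  have hsymm (j : ℕ) (hj : j ≤ m) : ρ (m - j) * ρ (m + j) = 1 := by
    have := hinv (m - j) (by omega)
    rwa [show m + m - (m - j) = m + j by omega] at this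
  induction k using Nat.twoStepInduction with
  | zero => simp
  | one => linear_combination -ρ (m + 1) * hmid
  | more k ihP ihQ =>
    have hP := ihP (by omega)
    have hQ := ihQ (by omega)
    have h1 := hsymm 1 (by omega)
    have hQQ := hsymm (k + 1) (by omega)
    have hSS := hsymm (k + 2) hk
    have hm := hrec m (by omega) (by omega)
    have hr := hrec (m + (k + 1)) (by omega) (by omega)
    have hl := hrec (m - (k + 1)) (by omega) (by omega)
    rw [show m + (k + 1) - 1 = m + k by omega,
      show m + (k + 1) + 1 = m + (k + 2) by omega] at hr
    rw [show m - (k + 1) - 1 = m - (k + 2) by omega] at hl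
    have hx : ρ m * ρ (m + 1) ≠ 0 :=
      mul_ne_zero (left_ne_zero_of_mul_eq_one hmid) (right_ne_zero_of_mul_eq_one h1)
    have hy : ρ (m + 1) = ρ m * (ρ m * ρ (m + 1)) := by
      linear_combination -ρ (m + 1) * hmid
    generalize ρ m * ρ (m + 1) = x at *
    have hchar : a + b * x + c * x ^ 2 = 0 := by
      rw [hy] at hm h1
      linear_combination ρ m * x * hm - a * h1 - (b * x + c * x ^ 2) * hmid
    by_cases hc : c = 0
    · subst hc
      have hb : b ≠ 0 := by
        rintro rfl
        exact habc ⟨by simpa using hchar, rfl, rfl⟩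
      refine mul_left_cancel₀ hb ?_
      have key : a * ρ (m + (k + 1)) + b * ρ (m + (k + 2)) = 0 := by
        linear_combination ρ (m + (k + 1)) * ρ (m + (k + 2)) * hl
          - a * ρ (m + (k + 1)) * hSS - b * ρ (m + (k + 2)) * hQQ
      rw [hQ] at key
      linear_combination key - ρ m * x ^ (k + 1) * hchar
    · refine mul_left_cancel₀ hc ?_
      rw [hP, hQ] at hr
      linear_combination hr - ρ m * x ^ k * hchar

theorem Constrained.exists_mul_pow_eq {F : Type*} [Field F] {m : ℕ} {ρ : ℕ → F}
    (h : Constrained F (m + m) ρ) :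
    ∃ r : F, r ≠ 0 ∧ ∃ ε : F, (ε = 1 ∨ ε = -1) ∧
      ∀ i ≤ m + m, ρ i * r ^ m = ε * r ^ i := by
  have hmid : ρ m * ρ m = 1 := by simpa using h.1 m (by omega)
  have hε : ρ m = 1 ∨ ρ m = -1 := mul_self_eq_one_iff.mp hmid
  rcases Nat.eq_zero_or_pos m with rfl | hm
  · refine ⟨1, one_ne_zero, ρ 0, hε, fun i hi => ?_⟩
    obtain rfl : i = 0 := by omega
    rfl
  · have hright := h.apply_add_eq
    have hx : ρ m * ρ (m + 1) ≠ 0 :=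
      mul_ne_zero (left_ne_zero_of_mul_eq_one hmid)
        (left_ne_zero_of_mul_eq_one (h.1 (m + 1) (by omega)))
    refine ⟨ρ m * ρ (m + 1), hx, ρ m, hε, fun i hi => ?_⟩
    generalize ρ m * ρ (m + 1) = x at *
    rcases le_total m i with hmi | him
    · obtain ⟨k, rfl⟩ := Nat.exists_eq_add_of_le hmi
      rw [hright k (by omega)]
      ring
    · obtain ⟨k, rfl⟩ := Nat.exists_eq_add_of_le him
      have hinv := h.1 i hi
      rw [show i + k + (i + k) - i = i + k + k by omega, hright k (by omega)] at hinv
      rw [pow_add]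
      linear_combination ρ (i + k) * x ^ i * hinv - ρ i * x ^ i * x ^ k * hmid

theorem eq_and_forall_eq_mul_of_mul_pow_eq {F : Type*} [Field F] {m : ℕ} {ρ : ℕ → F}
    {r ε : F} (hr : r ≠ 0) (h : ∀ i ≤ m + m, ρ i * r ^ m = ε * r ^ i) :
    ε = ρ m ∧ ∀ i : ℕ, 1 ≤ i → i ≤ m + m → ρ i = r * ρ (i - 1) := by
  have hrm : r ^ m ≠ 0 := pow_ne_zero m hr
  refine ⟨(mul_right_cancel₀ hrm (h m (by omega))).symm, fun i h1 hi => ?_⟩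
  obtain ⟨j, rfl⟩ := Nat.exists_eq_add_of_le' h1
  refine mul_right_cancel₀ hrm ?_
  rw [Nat.add_sub_cancel]
  linear_combination h (j + 1) hi - r * h j (by omega)

theorem geometricSeq_of_mul_pow_eq {F : Type*} [Field F] {m : ℕ} {ρ : ℕ → F}
    {r ε : F} (hr : r ≠ 0) (hε : ε ≠ 0) (h : ∀ i ≤ m + m, ρ i * r ^ m = ε * r ^ i) :
    GeometricSeq F (m + m) ρ :=
  ⟨fun i hi => left_ne_zero_of_mul ((h i hi).trans_ne (mul_ne_zero hε (pow_ne_zero i hr))),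
    r, (eq_and_forall_eq_mul_of_mul_pow_eq hr h).2⟩

theorem GeometricSeq.constrained {F : Type*} [Field F] {m : ℕ} {ρ : ℕ → F}
    (h : GeometricSeq F (m + m) ρ) (hm : ρ m * ρ m = 1) : Constrained F (m + m) ρ := by
  obtain ⟨-, r, hr⟩ := h
  have hpow (i : ℕ) (hi : i ≤ m + m) : ρ i = ρ 0 * r ^ i := by
    induction i with
    | zero => simp
    | succ i ih =>
      rw [hr (i + 1) (by omega) hi, Nat.add_sub_cancel, ih (by omega)]
      ring
  refine ⟨fun i hi => ?_, r, -1, 0, by simp, fun i h1 hi => ?_⟩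
  · have hsplit : r ^ i * r ^ (m + m - i) = r ^ m * r ^ m := by
      rw [← pow_add, ← pow_add, Nat.add_sub_cancel' hi]
    rw [hpow m (by omega)] at hm
    rw [hpow i hi, hpow (m + m - i) (by omega)]
    linear_combination hm + ρ 0 ^ 2 * hsplit
  · linear_combination -hr i h1 (by omega)

theorem stmt16 (F : Type*) [Field F] (n : ℕ) (hn : Even n) (ρ : ℕ → F) :
    ((Constrained F n ρ ↔
        GeometricSeq F n ρ ∧ (ρ (n / 2) = 1 ∨ ρ (n / 2) = -1)) ∧
      (Constrained F n ρ ↔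
        ∃ r : F, r ≠ 0 ∧ ∃ ε : F, (ε = 1 ∨ ε = -1) ∧
          ∀ i ≤ n, ρ i * r ^ (n / 2) = ε * r ^ i)) ∧
    (∀ r ε : F, r ≠ 0 → (ε = 1 ∨ ε = -1) →
      (∀ i ≤ n, ρ i * r ^ (n / 2) = ε * r ^ i) →
      ε = ρ (n / 2) ∧ ∀ i : ℕ, 1 ≤ i → i ≤ n → ρ i = r * ρ (i - 1)) := by
  obtain ⟨m, rfl⟩ := hn
  rw [show (m + m) / 2 = m by omega]
  have toGeom : (∃ r : F, r ≠ 0 ∧ ∃ ε : F, (ε = 1 ∨ ε = -1) ∧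
      ∀ i ≤ m + m, ρ i * r ^ m = ε * r ^ i) →
      GeometricSeq F (m + m) ρ ∧ (ρ m = 1 ∨ ρ m = -1) := by
    rintro ⟨r, hr, ε, hε, h⟩
    have hε0 : ε ≠ 0 := by rcases hε with rfl | rfl <;> simp
    exact ⟨geometricSeq_of_mul_pow_eq hr hε0 h,
      (eq_and_forall_eq_mul_of_mul_pow_eq hr h).1 ▸ hε⟩
  have ofGeom : GeometricSeq F (m + m) ρ ∧ (ρ m = 1 ∨ ρ m = -1) →
      Constrained F (m + m) ρ :=
    fun h => h.1.constrained (mul_self_eq_one_iff.mpr h.2)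
  exact ⟨⟨⟨fun h => toGeom h.exists_mul_pow_eq, ofGeom⟩,
    ⟨fun h => h.exists_mul_pow_eq, fun h => ofGeom (toGeom h)⟩⟩,
    fun r ε hr _ h => eq_and_forall_eq_mul_of_mul_pow_eq hr h⟩
end

section
/- Let F be a field, let n ≥ 1 be an odd integer, and let ρ_0,…,ρ_n be a sequence in F. The following are equivalent: (i) the sequence (ρ_i) is constrained; (ii) there exist nonzero s, ξ ∈ F such that ρ_i = ξ s^{i/2} for every even i with 0 ≤ i ≤ n, and ξ ρ_i s^{(n−i)/2} = 1 for every odd i with 0 ≤ i ≤ n. Moreover, if these conditions hold, then ξ = ρ_0 and s = ρ_i/ρ_{i−2} for 2 ≤ i ≤ n. -/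
/-- A constrained sequence satisfies a two-step recurrence with constant nonzero ratio. -/
theorem Constrained.exists_two_step {F : Type*} [Field F] {n : ℕ} {ρ : ℕ → F}
    (h : Constrained F n ρ) : ∃ s : F, s ≠ 0 ∧ ∀ i, i + 2 ≤ n → ρ (i + 2) = s * ρ i := by
  obtain ⟨hinv, a, b, c, habc, hrec⟩ := h
  have hne : ∀ i ≤ n, ρ i ≠ 0 := fun i hi => left_ne_zero_of_mul_eq_one (hinv i hi)
  have hrec' : ∀ i, i + 2 ≤ n → a * ρ i + b * ρ (i + 1) + c * ρ (i + 2) = 0 := fun i hi =>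
    hrec (i + 1) (by omega) (by omega)
  rcases Nat.lt_or_ge n 2 with hn | hn
  · exact ⟨1, one_ne_zero, fun i hi => by omega⟩
  by_cases hb : b = 0
  · subst hb
    have h0 := hrec' 0 hn
    have hρ0 := hne 0 (by omega)
    have hc : c ≠ 0 := by
      rintro rfl
      have ha : a = 0 := by simpa [hρ0] using h0
      exact habc ⟨ha, rfl, rfl⟩
    have ha : a ≠ 0 := by
      rintro rfl
      have hc0 : c = 0 := by simpa [hne 2 hn] using h0
      exact hc hc0
    refine ⟨-a / c, div_ne_zero (neg_ne_zero.mpr ha) hc, fun i hi => ?_⟩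
    field_simp
    linear_combination hrec' i hi
  · have hsq : ∀ i, i + 2 ≤ n → ρ (i + 1) ^ 2 = ρ i * ρ (i + 2) := by
      intro i hi
      have e := hrec' i hi
      have e' := hrec' (n - (i + 2)) (by omega)
      rw [show n - (i + 2) + 1 = n - (i + 1) by omega,
        show n - (i + 2) + 2 = n - i by omega] at e'
      have h0 := hinv i (by omega)
      have h1 := hinv (i + 1) (by omega)
      have h2 := hinv (i + 2) hi
      apply mul_left_cancel₀ hb
      linear_combination ρ (i + 1) * e - ρ i * ρ (i + 1) * ρ (i + 2) * e'
        + a * ρ i * ρ (i + 1) * h2 + b * ρ i * ρ (i + 2) * h1 + c * ρ (i + 1) * ρ (i + 2) * h0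
    have hρ0 := hne 0 (by omega)
    have hr : ∀ i, i + 1 ≤ n → ρ (i + 1) = ρ 1 / ρ 0 * ρ i := by
      intro i
      induction i with
      | zero => intro _; field_simp
      | succ i ih =>
        intro hi
        apply mul_left_cancel₀ (hne i (by omega))
        linear_combination -hsq i hi + ρ (i + 1) * ih (by omega)
    refine ⟨(ρ 1 / ρ 0) ^ 2, pow_ne_zero 2 (div_ne_zero (hne 1 (by omega)) hρ0), fun i hi => ?_⟩
    linear_combination hr (i + 1) hi + ρ 1 / ρ 0 * hr i (by omega)

/-- The explicit form of a sequence determines `ξ` and the two-step ratio `s`. -/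
theorem two_step_of_explicit {F : Type*} [Field F] {n : ℕ} {ρ : ℕ → F} {s ξ : F}
    (hs : s ≠ 0) (hξ : ξ ≠ 0) (heven : ∀ i ≤ n, Even i → ρ i = ξ * s ^ (i / 2))
    (hodd : ∀ i ≤ n, Odd i → ξ * ρ i * s ^ ((n - i) / 2) = 1) :
    ξ = ρ 0 ∧ ∀ i : ℕ, 2 ≤ i → i ≤ n → ρ i = s * ρ (i - 2) := by
  refine ⟨by simpa using (heven 0 (Nat.zero_le n) Even.zero).symm, fun i h2 hi => ?_⟩
  obtain ⟨j, rfl⟩ := Nat.exists_eq_add_of_le' h2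
  rw [Nat.add_sub_cancel]
  rcases Nat.even_or_odd j with hj | hj
  · rw [heven (j + 2) hi (by grind), heven j (by omega) hj,
      show (j + 2) / 2 = j / 2 + 1 by omega]
    ring
  · have e := hodd (j + 2) hi (by grind)
    have e' := hodd j (by omega) hj
    rw [show (n - j) / 2 = (n - (j + 2)) / 2 + 1 by omega] at e'
    apply mul_left_cancel₀ (mul_ne_zero hξ (pow_ne_zero ((n - (j + 2)) / 2) hs))
    linear_combination e - e'

theorem stmt17 (F : Type*) [Field F] (n : ℕ) (hn : Odd n) (ρ : ℕ → F) :
    (Constrained F n ρ ↔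
      ∃ s ξ : F, s ≠ 0 ∧ ξ ≠ 0 ∧
        (∀ i ≤ n, Even i → ρ i = ξ * s ^ (i / 2)) ∧
        (∀ i ≤ n, Odd i → ξ * ρ i * s ^ ((n - i) / 2) = 1)) ∧
    (∀ s ξ : F, s ≠ 0 → ξ ≠ 0 →
      (∀ i ≤ n, Even i → ρ i = ξ * s ^ (i / 2)) →
      (∀ i ≤ n, Odd i → ξ * ρ i * s ^ ((n - i) / 2) = 1) →
      ξ = ρ 0 ∧ ∀ i : ℕ, 2 ≤ i → i ≤ n → ρ i = s * ρ (i - 2)) := by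
  refine ⟨⟨fun h => ?_, ?_⟩, fun s ξ hs hξ => two_step_of_explicit hs hξ⟩
  · obtain ⟨s, hs, hstep⟩ := h.exists_two_step
    have heven : ∀ k, 2 * k ≤ n → ρ (2 * k) = ρ 0 * s ^ k := by
      intro k
      induction k with
      | zero => simp
      | succ k ih =>
        intro hk
        rw [mul_add, mul_one, hstep (2 * k) (by omega), ih (by omega)]
        ring
    have heven' : ∀ i ≤ n, Even i → ρ i = ρ 0 * s ^ (i / 2) := by
      intro i hi hi2
      rw [← heven (i / 2) (by omega), Nat.two_mul_div_two_of_even hi2]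
    refine ⟨s, ρ 0, hs, left_ne_zero_of_mul_eq_one (h.1 0 (Nat.zero_le n)), heven',
      fun i hi hi2 => ?_⟩
    have e := h.1 i hi
    rw [heven' (n - i) (Nat.sub_le n i) (Nat.Odd.sub_odd hn hi2)] at e
    linear_combination e
  · rintro ⟨s, ξ, hs, hξ, heven, hodd⟩
    have hstep := (two_step_of_explicit hs hξ heven hodd).2
    refine ⟨fun i hi => ?_, s, 0, -1, by simp, fun i h1 hi => ?_⟩
    · rcases Nat.even_or_odd i with hi2 | hi2
      · have e := hodd (n - i) (Nat.sub_le n i) (Nat.Odd.sub_even hi hn hi2)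
        rw [Nat.sub_sub_self hi] at e
        rw [heven i hi hi2]
        linear_combination e
      · rw [heven (n - i) (Nat.sub_le n i) (Nat.Odd.sub_odd hn hi2)]
        linear_combination hodd i hi hi2
    · rw [hstep (i + 1) (by omega) hi, show i + 1 - 2 = i - 1 by omega]
      ring
end
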